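/- For every integer a ≥ 1, the operator S_a is a Banach isomorphism from L²((0,1),ℂ) onto the orthogonal complement in L²((0,1),ℂ) of the function x ↦ x^{2a}; the operator A_a defined by A_a[g](x) = g(x) − (4a/x^{2a+1}) ∫₀^x t^{2a} g(t) dt is bounded on L²((0,1),ℂ) and inverts S_a: A_a S_a = Id on L²((0,1),ℂ), and S_a A_a = Id on the orthogonal complement of x ↦ x^{2a}. -/

import Mathlib

open MeasureTheory Complex Filter intervalIntegral

noncomputable section

/-- Riccati–Bessel function `j_a`. -/
def jb : ℕ → ℂ → ℂ
  | 0 => Complex.sin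
  | a + 1 => fun z => (((a : ℕ) + 1 : ℂ)) / z * jb a z - deriv (jb a) z

/-- Riccati–Bessel function `η_a`. -/
def yb : ℕ → ℂ → ℂ
  | 0 => Complex.cos
  | a + 1 => fun z => (((a : ℕ) + 1 : ℂ)) / z * yb a z - deriv (yb a) z

/-- The double factorial `(2a+1)!!`. -/
def dfact (a : ℕ) : ℕ := ∏ i ∈ Finset.range (a + 1), (2 * i + 1)

/-- A square root of a complex number. -/
def sqrtC (lam : ℂ) : ℂ := lam ^ (1/2 : ℂ)

/-- The regular solution `u(x,λ)` of the free singular equation. -/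
def uSol (a : ℕ) (x : ℝ) (lam : ℂ) : ℂ :=
  (dfact a : ℂ) / sqrtC lam ^ (a + 1) * jb a (sqrtC lam * x)

/-- The singular solution `v(x,λ)` of the free singular equation. -/
def vSol (a : ℕ) (x : ℝ) (lam : ℂ) : ℂ :=
  -(sqrtC lam ^ a / (dfact a : ℂ)) * yb a (sqrtC lam * x)

/-- The Green function `G(x,t,λ)`. -/
def green (a : ℕ) (x t : ℝ) (lam : ℂ) : ℂ :=
  vSol a x lam * uSol a t lam - uSol a x lam * vSol a t lam

/-- The Picard iterates `φ_k`. -/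
def phiIter (a : ℕ) (q : ℝ → ℂ) : ℕ → ℝ → ℂ → ℂ
  | 0 => fun x lam => uSol a x lam
  | k + 1 => fun x lam => ∫ t in (0:ℝ)..x, green a x t lam * q t * phiIter a q k t lam

/-- The regular solution `φ(x,λ,q)`. -/
def phiSol (a : ℕ) (q : ℝ → ℂ) (x : ℝ) (lam : ℂ) : ℂ := ∑' k, phiIter a q k x lam

/-- The Picard iterates `ψ̃_k`. -/
def psiIter (a : ℕ) (q : ℝ → ℂ) : ℕ → ℝ → ℂ → ℂ
  | 0 => fun x lam => vSol a x lam
  | k + 1 => fun x lam => -∫ t in x..(1:ℝ), green a x t lam * q t * psiIter a q k t lam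

/-- The singular solution `ψ̃(x,λ,q)`. -/
def psiSol (a : ℕ) (q : ℝ → ℂ) (x : ℝ) (lam : ℂ) : ℂ := ∑' k, psiIter a q k x lam

/-- Lebesgue measure restricted to `(0,1)`. -/
def mu01 : Measure ℝ := volume.restrict (Set.Ioo 0 1)


open scoped ENNReal

/-- A real kernel whose absolute row and column integrals are almost everywhere at most `1`. -/
structure IsSchurKernel {α : Type*} [MeasurableSpace α] (μ : Measure α) (k : α → α → ℝ) :
    Prop where
  measurable : Measurable (Function.uncurry k)
  row_le : ∀ᵐ x ∂μ, ∫⁻ t, ‖k x t‖ₑ ∂μ ≤ 1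
  col_le : ∀ᵐ t ∂μ, ∫⁻ x, ‖k x t‖ₑ ∂μ ≤ 1

section Schur

variable {α : Type*} [MeasurableSpace α] {μ : Measure α}

theorem lintegral_mul_sq_le {k f : α → ℝ≥0∞} (hk : AEMeasurable k μ) (hf : AEMeasurable f μ) :
    (∫⁻ t, k t * f t ∂μ) ^ 2 ≤ (∫⁻ t, k t ∂μ) * ∫⁻ t, k t * f t ^ 2 ∂μ := by
  have h := ENNReal.lintegral_mul_le_Lp_mul_Lq μ Real.HolderConjugate.two_two
    (hk.pow_const (1 / 2 : ℝ)) ((hk.pow_const (1 / 2 : ℝ)).mul hf)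
  have e1 : ∀ t, (k t ^ (1 / 2 : ℝ)) ^ (2 : ℝ) = k t := fun t => by
    rw [← ENNReal.rpow_mul]; norm_num
  have e2 : ∀ t, k t ^ (1 / 2 : ℝ) * (k t ^ (1 / 2 : ℝ) * f t) = k t * f t := fun t => by
    rw [← mul_assoc, ← ENNReal.rpow_add_of_nonneg _ _ (by norm_num) (by norm_num)]; norm_num
  simp only [Pi.mul_apply, ENNReal.mul_rpow_of_nonneg _ _ zero_le_two, e1, e2,
    ENNReal.rpow_two] at h
  calc _ ≤ ((∫⁻ t, k t ∂μ) ^ (1 / 2 : ℝ) * (∫⁻ t, k t * f t ^ 2 ∂μ) ^ (1 / 2 : ℝ)) ^ 2 := by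
        gcongr
    _ = _ := by
        rw [mul_pow, ← ENNReal.rpow_two, ← ENNReal.rpow_two, ← ENNReal.rpow_mul,
          ← ENNReal.rpow_mul]
        norm_num

theorem lintegral_enorm_sq_lt_top {E : Type*} [NormedAddCommGroup E] {f : α → E}
    (hf : MemLp f 2 μ) : ∫⁻ t, ‖f t‖ₑ ^ 2 ∂μ < ∞ := by
  simpa using lintegral_rpow_enorm_lt_top_of_eLpNorm_lt_top (by norm_num) (by norm_num) hf.2

variable [SFinite μ]

namespace IsSchurKernel

variable {k l : α → α → ℝ}

theorem lintegral_sq_le (hk : IsSchurKernel μ k) {f : α → ℝ≥0∞} (hf : AEMeasurable f μ) :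
    ∫⁻ x, (∫⁻ t, ‖k x t‖ₑ * f t ∂μ) ^ 2 ∂μ ≤ ∫⁻ t, f t ^ 2 ∂μ := by
  have hm := hk.measurable.enorm
  calc ∫⁻ x, (∫⁻ t, ‖k x t‖ₑ * f t ∂μ) ^ 2 ∂μ
      ≤ ∫⁻ x, ∫⁻ t, ‖k x t‖ₑ * f t ^ 2 ∂μ ∂μ := by
        refine lintegral_mono_ae ?_
        filter_upwards [hk.row_le] with x hx
        refine (lintegral_mul_sq_le
          (hm.comp measurable_prodMk_left).aemeasurable hf).trans ?_
        exact mul_le_of_le_one_left' hx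
    _ = ∫⁻ t, ∫⁻ x, ‖k x t‖ₑ * f t ^ 2 ∂μ ∂μ :=
        lintegral_lintegral_swap
          (f := fun x t => ‖k x t‖ₑ * f t ^ 2)
          (by exact hm.aemeasurable.mul (hf.pow_const 2).comp_snd)
    _ = ∫⁻ t, (∫⁻ x, ‖k x t‖ₑ ∂μ) * f t ^ 2 ∂μ := by
        refine lintegral_congr fun t => ?_
        exact lintegral_mul_const _ (hm.comp measurable_prodMk_right)
    _ ≤ _ := by
        refine lintegral_mono_ae ?_
        filter_upwards [hk.col_le] with t ht
        exact mul_le_of_le_one_left' ht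

theorem aemeasurable_lintegral (hk : IsSchurKernel μ k) {f : α → ℝ≥0∞}
    (hf : AEMeasurable f μ) : AEMeasurable (fun x => ∫⁻ t, ‖k x t‖ₑ * f t ∂μ) μ :=
  (hk.measurable.enorm.aemeasurable.mul hf.comp_snd).lintegral_prod_right'

theorem ae_lintegral_lt_top (hk : IsSchurKernel μ k) {f : α → ℝ≥0∞} (hf : AEMeasurable f μ)
    (hf' : ∫⁻ t, f t ^ 2 ∂μ < ∞) : ∀ᵐ x ∂μ, ∫⁻ t, ‖k x t‖ₑ * f t ∂μ < ∞ := by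
  have h := ae_lt_top' ((hk.aemeasurable_lintegral hf).pow_const 2)
    ((hk.lintegral_sq_le hf).trans_lt hf').ne
  filter_upwards [h] with x hx
  simpa using hx

variable {E : Type*} [NormedAddCommGroup E] [NormedSpace ℝ E] {f : α → E}

theorem ae_integrable (hk : IsSchurKernel μ k) (hf : MemLp f 2 μ) :
    ∀ᵐ x ∂μ, Integrable (fun t => k x t • f t) μ := by
  filter_upwards [hk.ae_lintegral_lt_top hf.1.enorm (lintegral_enorm_sq_lt_top hf)] with x hx
  refine ⟨(hk.measurable.comp measurable_prodMk_left).aestronglyMeasurable.smul hf.1, ?_⟩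
  simpa [HasFiniteIntegral, enorm_smul] using hx

theorem aestronglyMeasurable_integral (hk : IsSchurKernel μ k) (hf : AEStronglyMeasurable f μ) :
    AEStronglyMeasurable (fun x => ∫ t, k x t • f t ∂μ) μ :=
  (hk.measurable.aestronglyMeasurable.smul hf.comp_snd).integral_prod_right'

theorem eLpNorm_integral_le (hk : IsSchurKernel μ k) (hf : AEStronglyMeasurable f μ) :
    eLpNorm (fun x => ∫ t, k x t • f t ∂μ) 2 μ ≤ eLpNorm f 2 μ := by
  rw [eLpNorm_eq_lintegral_rpow_enorm_toReal two_ne_zero ENNReal.ofNat_ne_top,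
    eLpNorm_eq_lintegral_rpow_enorm_toReal two_ne_zero ENNReal.ofNat_ne_top]
  simp only [ENNReal.toReal_ofNat, ENNReal.rpow_two]
  refine ENNReal.rpow_le_rpow ?_ (by norm_num)
  refine le_trans (lintegral_mono fun x => ?_) (hk.lintegral_sq_le hf.enorm)
  gcongr
  refine (enorm_integral_le_lintegral_enorm _).trans ?_
  simp [enorm_smul]

theorem memLp_integral (hk : IsSchurKernel μ k) (hf : MemLp f 2 μ) :
    MemLp (fun x => ∫ t, k x t • f t ∂μ) 2 μ :=
  ⟨hk.aestronglyMeasurable_integral hf.1, (hk.eLpNorm_integral_le hf.1).trans_lt hf.2⟩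

/-- The integral operator on `L²` with a Schur kernel. -/
theorem exists_continuousLinearMap (hk : IsSchurKernel μ k) :
    ∃ T : Lp ℂ 2 μ →L[ℂ] Lp ℂ 2 μ,
      ∀ f : Lp ℂ 2 μ, (T f : α → ℂ) =ᵐ[μ] fun x => ∫ t, k x t • f t ∂μ := by
  let T : Lp ℂ 2 μ →ₗ[ℂ] Lp ℂ 2 μ :=
    { toFun f := (hk.memLp_integral (Lp.memLp f)).toLp
      map_add' f g := by
        refine Lp.ext ?_
        filter_upwards [Lp.coeFn_add ((hk.memLp_integral (Lp.memLp f)).toLp)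
            ((hk.memLp_integral (Lp.memLp g)).toLp),
          (hk.memLp_integral (Lp.memLp (f + g))).coeFn_toLp,
          (hk.memLp_integral (Lp.memLp f)).coeFn_toLp,
          (hk.memLp_integral (Lp.memLp g)).coeFn_toLp,
          hk.ae_integrable (Lp.memLp f), hk.ae_integrable (Lp.memLp g)] with x h1 h2 h3 h4 h5 h6
        rw [h1, h2, Pi.add_apply, h3, h4, ← integral_add h5 h6]
        refine integral_congr_ae ?_
        filter_upwards [Lp.coeFn_add f g] with t ht
        simp only [ht, Pi.add_apply, smul_add]
      map_smul' c f := by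
        refine Lp.ext ?_
        filter_upwards [Lp.coeFn_smul c ((hk.memLp_integral (Lp.memLp f)).toLp),
          (hk.memLp_integral (Lp.memLp (c • f))).coeFn_toLp,
          (hk.memLp_integral (Lp.memLp f)).coeFn_toLp] with x h1 h2 h3
        rw [RingHom.id_apply, h1, h2, Pi.smul_apply, h3, ← MeasureTheory.integral_smul]
        refine integral_congr_ae ?_
        filter_upwards [Lp.coeFn_smul c f] with t ht
        simp only [ht, Pi.smul_apply, smul_comm c] }
  refine ⟨T.mkContinuous 1 fun f => ?_, fun f => (hk.memLp_integral (Lp.memLp f)).coeFn_toLp⟩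
  rw [one_mul, Lp.norm_def f]
  change ‖(hk.memLp_integral (Lp.memLp f)).toLp‖ ≤ _
  rw [Lp.norm_toLp]
  exact ENNReal.toReal_mono (Lp.eLpNorm_ne_top f) (hk.eLpNorm_integral_le (Lp.memLp f).1)

theorem ae_integral_integral [CompleteSpace E] (hk : IsSchurKernel μ k) (hl : IsSchurKernel μ l)
    (hf : MemLp f 2 μ) :
    ∀ᵐ x ∂μ, ∫ s, k x s • ∫ t, l s t • f t ∂μ ∂μ = ∫ t, (∫ s, k x s * l s t ∂μ) • f t ∂μ := by
  have hg := hl.aemeasurable_lintegral hf.1.enorm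
  have hg' := (hl.lintegral_sq_le hf.1.enorm).trans_lt (lintegral_enorm_sq_lt_top hf)
  filter_upwards [hk.ae_lintegral_lt_top hg hg'] with x hx
  have hkx : Measurable (k x) := hk.measurable.comp measurable_prodMk_left
  have hint : Integrable (Function.uncurry fun s t => (k x s * l s t) • f t) (μ.prod μ) := by
    have hm : AEStronglyMeasurable (Function.uncurry fun s t => (k x s * l s t) • f t)
        (μ.prod μ) :=
      ((hkx.comp measurable_fst).mul hl.measurable).aestronglyMeasurable.smul hf.1.comp_snd
    refine ⟨hm, ?_⟩
    rw [HasFiniteIntegral, lintegral_prod _ hm.enorm]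
    refine lt_of_eq_of_lt (lintegral_congr fun s => ?_) hx
    simp only [Function.uncurry, enorm_smul, enorm_mul, mul_assoc]
    exact lintegral_const_mul' _ _ enorm_ne_top
  calc _ = ∫ s, ∫ t, (k x s * l s t) • f t ∂μ ∂μ := by
        simp only [mul_smul, MeasureTheory.integral_smul]
    _ = ∫ t, ∫ s, (k x s * l s t) • f t ∂μ ∂μ := integral_integral_swap hint
    _ = _ := by simp only [_root_.integral_smul_const]

end IsSchurKernel

end Schur

section Interval

instance : IsFiniteMeasure mu01 := inferInstanceAs (IsFiniteMeasure (volume.restrict _))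

instance : NeZero mu01 := ⟨by simp [mu01]⟩

theorem ae_mu01_mem_Ioo : ∀ᵐ x ∂mu01, x ∈ Set.Ioo (0 : ℝ) 1 :=
  ae_restrict_mem measurableSet_Ioo

section

variable {E : Type*} [NormedAddCommGroup E] [NormedSpace ℝ E] {c : ℝ}

theorem integral_mu01_eq (F : ℝ → E) : ∫ t, F t ∂mu01 = ∫ t in (0 : ℝ)..1, F t := by
  rw [integral_of_le zero_le_one, integral_Ioc_eq_integral_Ioo, mu01]

theorem integral_mu01_ite_lt (hc : c ∈ Set.Ioo (0 : ℝ) 1) (F : ℝ → E) :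
    ∫ t, (if c < t then F t else 0) ∂mu01 = ∫ t in c..1, F t := by
  have h : (fun t => if c < t then F t else 0) = (Set.Ioi c).indicator F := by
    ext t; simp [Set.indicator]
  rw [h, MeasureTheory.integral_indicator measurableSet_Ioi, mu01, Measure.restrict_restrict measurableSet_Ioi,
    integral_of_le hc.2.le, integral_Ioc_eq_integral_Ioo]
  congr 2
  ext t
  simp only [Set.mem_inter_iff, Set.mem_Ioi, Set.mem_Ioo]
  exact ⟨fun h => ⟨h.1, h.2.2⟩, fun h => ⟨h.1, hc.1.trans h.1, h.2⟩⟩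

theorem integral_mu01_ite_le (hc : c ∈ Set.Ioo (0 : ℝ) 1) (F : ℝ → E) :
    ∫ t, (if t ≤ c then F t else 0) ∂mu01 = ∫ t in (0 : ℝ)..c, F t := by
  have h : (fun t => if t ≤ c then F t else 0) = (Set.Iic c).indicator F := by
    ext t; simp [Set.indicator]
  rw [h, MeasureTheory.integral_indicator measurableSet_Iic, mu01, Measure.restrict_restrict measurableSet_Iic,
    integral_of_le hc.1.le]
  congr 2
  ext t
  simp only [Set.mem_inter_iff, Set.mem_Iic, Set.mem_Ioo, Set.mem_Ioc]
  exact ⟨fun h => ⟨h.2.1, h.1⟩, fun h => ⟨h.2, h.1, h.2.trans_lt hc.2⟩⟩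

theorem ae_mu01_ne (c : ℝ) : ∀ᵐ t ∂mu01, t ≠ c :=
  ae_restrict_of_ae (Measure.ae_ne volume c)

theorem integral_mu01_ite_le' (hc : c ∈ Set.Ioo (0 : ℝ) 1) (F : ℝ → E) :
    ∫ t, (if c ≤ t then F t else 0) ∂mu01 = ∫ t in c..1, F t := by
  rw [← integral_mu01_ite_lt hc]
  refine integral_congr_ae ?_
  filter_upwards [ae_mu01_ne c] with t ht
  simp only [lt_iff_le_and_ne, ne_eq, ht.symm, not_false_eq_true, and_true]

theorem integral_mu01_ite_lt' (hc : c ∈ Set.Ioo (0 : ℝ) 1) (F : ℝ → E) :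
    ∫ t, (if t < c then F t else 0) ∂mu01 = ∫ t in (0 : ℝ)..c, F t := by
  rw [← integral_mu01_ite_le hc]
  refine integral_congr_ae ?_
  filter_upwards [ae_mu01_ne c] with t ht
  simp only [lt_iff_le_and_ne, ne_eq, ht, not_false_eq_true, and_true]

end

theorem lintegral_enorm_mu01_le_one {f : ℝ → ℝ} {C : ℝ} (hf : Measurable f)
    (h0 : ∀ᵐ t ∂mu01, 0 ≤ f t) (hC : ∀ᵐ t ∂mu01, f t ≤ C) (h1 : ∫ t, f t ∂mu01 ≤ 1) :
    ∫⁻ t, ‖f t‖ₑ ∂mu01 ≤ 1 := by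
  have hb : ∀ᵐ t ∂mu01, ‖f t‖ ≤ C := by
    filter_upwards [h0, hC] with t h h'
    rwa [Real.norm_of_nonneg h]
  have hi : Integrable f mu01 := Integrable.of_bound hf.aestronglyMeasurable C hb
  rw [← ofReal_integral_norm_eq_lintegral_enorm hi, ENNReal.ofReal_le_one]
  refine (MeasureTheory.integral_congr_ae ?_).trans_le h1
  filter_upwards [h0] with t h
  rw [Real.norm_of_nonneg h]

theorem integral_inv_pow_succ {c : ℝ} (hc : 0 < c) {m : ℕ} (hm : m ≠ 0) :
    ∫ t in c..1, (t ^ (m + 1))⁻¹ = ((c ^ m)⁻¹ - 1) / m := by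
  have h := integral_zpow (a := c) (b := 1) (n := -((m + 1 : ℕ) : ℤ))
    (Or.inr ⟨by omega, Set.notMem_uIcc_of_lt hc one_pos⟩)
  simp only [zpow_neg, zpow_natCast] at h
  have e : (-((m + 1 : ℕ) : ℤ) + 1) = -(m : ℤ) := by push_cast; ring
  have hm' : (m : ℝ) ≠ 0 := Nat.cast_ne_zero.2 hm
  rw [h, e, one_zpow, zpow_neg, zpow_natCast]
  have e2 : ((-((m + 1 : ℕ) : ℤ) : ℤ) : ℝ) + 1 = -(m : ℝ) := by push_cast; ring
  rw [e2]
  field_simp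
  ring

end Interval

/-- The Hardy-type kernel `x ^ m / t ^ (m + 1)` supported on `x < t`. -/
def upperKernel (m : ℕ) (x t : ℝ) : ℝ := if x < t then x ^ m / t ^ (m + 1) else 0

/-- The Hardy-type kernel `t ^ m / x ^ (m + 1)` supported on `t ≤ x`. -/
def lowerKernel (m : ℕ) (x t : ℝ) : ℝ := if t ≤ x then t ^ m / x ^ (m + 1) else 0

section Kernels

variable {m : ℕ} {x t : ℝ}

theorem pow_div_pow_succ_le_inv (hx : 0 ≤ x) (ht : 0 < t) (h : x ≤ t) :
    x ^ m / t ^ (m + 1) ≤ t⁻¹ := by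
  rw [div_le_iff₀ (by positivity), pow_succ', inv_mul_cancel_left₀ ht.ne']
  gcongr

theorem upperKernel_nonneg (hx : 0 ≤ x) (ht : 0 ≤ t) : 0 ≤ upperKernel m x t := by
  unfold upperKernel; split_ifs <;> positivity

theorem lowerKernel_nonneg (hx : 0 ≤ x) (ht : 0 ≤ t) : 0 ≤ lowerKernel m x t := by
  unfold lowerKernel; split_ifs <;> positivity

theorem upperKernel_le_inv_right (hx : 0 < x) (ht : 0 < t) : upperKernel m x t ≤ t⁻¹ := by
  unfold upperKernel
  split_ifs with h
  · exact pow_div_pow_succ_le_inv hx.le ht h.le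
  · positivity

theorem upperKernel_le_inv_left (hx : 0 < x) (ht : 0 < t) : upperKernel m x t ≤ x⁻¹ := by
  unfold upperKernel
  split_ifs with h
  · exact (pow_div_pow_succ_le_inv hx.le ht h.le).trans (inv_anti₀ hx h.le)
  · positivity

theorem lowerKernel_le_inv_left (hx : 0 < x) (ht : 0 < t) : lowerKernel m x t ≤ x⁻¹ := by
  unfold lowerKernel
  split_ifs with h
  · exact pow_div_pow_succ_le_inv ht.le hx h
  · positivity

theorem lowerKernel_le_inv_right (hx : 0 < x) (ht : 0 < t) : lowerKernel m x t ≤ t⁻¹ := by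
  unfold lowerKernel
  split_ifs with h
  · exact (pow_div_pow_succ_le_inv ht.le hx h).trans (inv_anti₀ ht h)
  · positivity

theorem measurable_upperKernel : Measurable (Function.uncurry (upperKernel m)) := by
  unfold upperKernel
  exact Measurable.ite (measurableSet_lt measurable_fst measurable_snd) (by fun_prop)
    measurable_const

theorem measurable_lowerKernel : Measurable (Function.uncurry (lowerKernel m)) := by
  unfold lowerKernel
  exact Measurable.ite (measurableSet_le measurable_snd measurable_fst) (by fun_prop)
    measurable_const

theorem integral_pow_div_pow_succ (hx : 0 < x) :
    ∫ t in (0 : ℝ)..x, t ^ m / x ^ (m + 1) = 1 / (m + 1) := by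
  rw [intervalIntegral.integral_div, integral_pow]
  field_simp
  simp

theorem integral_pow_div_pow_succ_le_one (hx : 0 < x) (hm : m ≠ 0) :
    ∫ t in x..1, x ^ m / t ^ (m + 1) ≤ 1 := by
  have hm1 : (1 : ℝ) ≤ m := by exact_mod_cast Nat.one_le_iff_ne_zero.2 hm
  simp only [div_eq_mul_inv]
  rw [intervalIntegral.integral_const_mul, integral_inv_pow_succ hx hm, ← mul_div_assoc, mul_sub,
    mul_inv_cancel₀ (by positivity), div_le_one (by positivity)]
  have : 0 < x ^ m := by positivity
  linarith

theorem isSchurKernel_upperKernel (hm : m ≠ 0) : IsSchurKernel mu01 (upperKernel m) where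
  measurable := measurable_upperKernel
  row_le := by
    filter_upwards [ae_mu01_mem_Ioo] with x hx
    refine lintegral_enorm_mu01_le_one (C := x⁻¹)
      (measurable_upperKernel.comp measurable_prodMk_left) ?_ ?_ ?_
    · filter_upwards [ae_mu01_mem_Ioo] with t ht using upperKernel_nonneg hx.1.le ht.1.le
    · filter_upwards [ae_mu01_mem_Ioo] with t ht using upperKernel_le_inv_left hx.1 ht.1
    · unfold upperKernel
      rw [integral_mu01_ite_lt hx]
      exact integral_pow_div_pow_succ_le_one hx.1 hm
  col_le := by
    filter_upwards [ae_mu01_mem_Ioo] with t ht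
    refine lintegral_enorm_mu01_le_one (C := t⁻¹)
      (measurable_upperKernel.comp measurable_prodMk_right) ?_ ?_ ?_
    · filter_upwards [ae_mu01_mem_Ioo] with x hx using upperKernel_nonneg hx.1.le ht.1.le
    · filter_upwards [ae_mu01_mem_Ioo] with x hx using upperKernel_le_inv_right hx.1 ht.1
    · unfold upperKernel
      rw [integral_mu01_ite_lt' ht, integral_pow_div_pow_succ ht.1, div_le_one (by positivity)]
      linarith [(Nat.cast_nonneg m : (0 : ℝ) ≤ m)]

theorem isSchurKernel_lowerKernel (hm : m ≠ 0) : IsSchurKernel mu01 (lowerKernel m) where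
  measurable := measurable_lowerKernel
  row_le := by
    filter_upwards [ae_mu01_mem_Ioo] with x hx
    refine lintegral_enorm_mu01_le_one (C := x⁻¹)
      (measurable_lowerKernel.comp measurable_prodMk_left) ?_ ?_ ?_
    · filter_upwards [ae_mu01_mem_Ioo] with t ht using lowerKernel_nonneg hx.1.le ht.1.le
    · filter_upwards [ae_mu01_mem_Ioo] with t ht using lowerKernel_le_inv_left hx.1 ht.1
    · unfold lowerKernel
      rw [integral_mu01_ite_le hx, integral_pow_div_pow_succ hx.1, div_le_one (by positivity)]
      linarith [(Nat.cast_nonneg m : (0 : ℝ) ≤ m)]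
  col_le := by
    filter_upwards [ae_mu01_mem_Ioo] with t ht
    refine lintegral_enorm_mu01_le_one (C := t⁻¹)
      (measurable_lowerKernel.comp measurable_prodMk_right) ?_ ?_ ?_
    · filter_upwards [ae_mu01_mem_Ioo] with x hx using lowerKernel_nonneg hx.1.le ht.1.le
    · filter_upwards [ae_mu01_mem_Ioo] with x hx using lowerKernel_le_inv_right hx.1 ht.1
    · unfold lowerKernel
      rw [integral_mu01_ite_le' ht]
      exact integral_pow_div_pow_succ_le_one ht.1 hm

theorem integral_lowerKernel_mul_upperKernel (hx : x ∈ Set.Ioo (0 : ℝ) 1)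
    (ht : t ∈ Set.Ioo (0 : ℝ) 1) :
    ∫ s, lowerKernel (m + 1) x s * upperKernel m s t ∂mu01 =
      (2 * m + 2 : ℝ)⁻¹ * (lowerKernel (m + 1) x t + upperKernel m x t) := by
  have hx0 := hx.1
  have ht0 := ht.1
  have hprim (c : ℝ) : ∫ s in (0 : ℝ)..c, s ^ (m + 1) / x ^ (m + 1 + 1) * (s ^ m / t ^ (m + 1)) =
      (x ^ (m + 2))⁻¹ * (t ^ (m + 1))⁻¹ * (c ^ (2 * m + 2) / (2 * m + 2)) := by
    have e : ∀ s : ℝ, s ^ (m + 1) / x ^ (m + 1 + 1) * (s ^ m / t ^ (m + 1)) =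
        (x ^ (m + 2))⁻¹ * (t ^ (m + 1))⁻¹ * s ^ (2 * m + 1) := fun s => by ring
    simp only [e]
    rw [intervalIntegral.integral_const_mul, integral_pow]
    push_cast
    simp only [ne_eq, Nat.add_eq_zero_iff, one_ne_zero, and_false, not_false_eq_true, zero_pow,
      sub_zero]
    ring_nf
  rcases lt_or_ge x t with h | h
  · have e : ∀ s, lowerKernel (m + 1) x s * upperKernel m s t =
        if s ≤ x then s ^ (m + 1) / x ^ (m + 1 + 1) * (s ^ m / t ^ (m + 1)) else 0 := fun s => by
      unfold lowerKernel upperKernel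
      by_cases hs : s ≤ x
      · simp [hs, hs.trans_lt h]
      · simp [hs]
    simp only [e]
    rw [integral_mu01_ite_le hx, hprim, lowerKernel, upperKernel, if_neg h.not_ge, if_pos h]
    field_simp
    ring
  · have e : ∀ s, lowerKernel (m + 1) x s * upperKernel m s t =
        if s < t then s ^ (m + 1) / x ^ (m + 1 + 1) * (s ^ m / t ^ (m + 1)) else 0 := fun s => by
      unfold lowerKernel upperKernel
      by_cases hs : s < t
      · simp [hs, hs.le.trans h]
      · simp [hs]
    simp only [e]
    rw [integral_mu01_ite_lt' ht, hprim, lowerKernel, upperKernel, if_pos h, if_neg h.not_gt]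
    field_simp
    ring

theorem integral_upperKernel_mul_lowerKernel (hx : x ∈ Set.Ioo (0 : ℝ) 1)
    (ht : t ∈ Set.Ioo (0 : ℝ) 1) :
    ∫ s, upperKernel m x s * lowerKernel (m + 1) s t ∂mu01 =
      (2 * m + 2 : ℝ)⁻¹ *
        (lowerKernel (m + 1) x t + upperKernel m x t - x ^ m * t ^ (m + 1)) := by
  have hx0 := hx.1
  have ht0 := ht.1
  have hprim {c : ℝ} (hc : 0 < c) :
      ∫ s in c..1, x ^ m / s ^ (m + 1) * (t ^ (m + 1) / s ^ (m + 1 + 1)) =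
      x ^ m * t ^ (m + 1) * (((c ^ (2 * m + 2))⁻¹ - 1) / (2 * m + 2)) := by
    have e : ∀ s : ℝ, x ^ m / s ^ (m + 1) * (t ^ (m + 1) / s ^ (m + 1 + 1)) =
        x ^ m * t ^ (m + 1) * (s ^ (2 * m + 2 + 1))⁻¹ := fun s => by ring
    simp only [e]
    rw [intervalIntegral.integral_const_mul, integral_inv_pow_succ hc (by omega)]
    push_cast
    rfl
  rcases lt_or_ge x t with h | h
  · have e : ∀ s, upperKernel m x s * lowerKernel (m + 1) s t =
        if t ≤ s then x ^ m / s ^ (m + 1) * (t ^ (m + 1) / s ^ (m + 1 + 1)) else 0 := fun s => by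
      unfold lowerKernel upperKernel
      by_cases hs : t ≤ s
      · simp [hs, h.trans_le hs]
      · simp [hs]
    simp only [e]
    rw [integral_mu01_ite_le' ht, hprim ht0, lowerKernel, upperKernel, if_neg h.not_ge, if_pos h]
    field_simp
    ring
  · have e : ∀ s, upperKernel m x s * lowerKernel (m + 1) s t =
        if x < s then x ^ m / s ^ (m + 1) * (t ^ (m + 1) / s ^ (m + 1 + 1)) else 0 := fun s => by
      unfold lowerKernel upperKernel
      by_cases hs : x < s
      · simp [hs, h.trans hs.le]
      · simp [hs]
    simp only [e]
    rw [integral_mu01_ite_lt hx, hprim hx0, lowerKernel, upperKernel, if_pos h, if_neg h.not_gt]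
    field_simp
    ring

theorem integral_upperKernel_smul (hx : x ∈ Set.Ioo (0 : ℝ) 1) (f : ℝ → ℂ) :
    ∫ t, upperKernel m x t • f t ∂mu01 = (x : ℂ) ^ m * ∫ t in x..1, f t / (t : ℂ) ^ (m + 1) := by
  simp only [upperKernel, ite_smul, zero_smul]
  rw [integral_mu01_ite_lt hx, ← intervalIntegral.integral_const_mul]
  congr 1
  ext t
  rw [real_smul]
  push_cast
  ring

theorem integral_lowerKernel_smul (hx : x ∈ Set.Ioo (0 : ℝ) 1) (f : ℝ → ℂ) :
    ∫ t, lowerKernel m x t • f t ∂mu01 =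
      ((x : ℂ) ^ (m + 1))⁻¹ * ∫ t in (0 : ℝ)..x, (t : ℂ) ^ m * f t := by
  simp only [lowerKernel, ite_smul, zero_smul]
  rw [integral_mu01_ite_le hx, ← intervalIntegral.integral_const_mul]
  congr 1
  ext t
  rw [real_smul]
  push_cast
  ring

variable {f : ℝ → ℂ}

theorem integrable_pow_smul (hf : MemLp f 2 mu01) (n : ℕ) :
    Integrable (fun t => t ^ n • f t) mu01 := by
  refine (hf.integrable one_le_two).bdd_smul 1
    (by fun_prop : Measurable fun t : ℝ => t ^ n).aestronglyMeasurable ?_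
  filter_upwards [ae_mu01_mem_Ioo] with t ht
  rw [Real.norm_of_nonneg (by have := ht.1; positivity)]
  exact pow_le_one₀ ht.1.le ht.2.le

theorem ae_lowerKernel_upperKernel_comp (hm : m ≠ 0) (hf : MemLp f 2 mu01) :
    ∀ᵐ x ∂mu01,
      ∫ s, lowerKernel (m + 1) x s • ∫ t, upperKernel m s t • f t ∂mu01 ∂mu01 =
        (2 * m + 2 : ℝ)⁻¹ • (∫ t, lowerKernel (m + 1) x t • f t ∂mu01 +
          ∫ t, upperKernel m x t • f t ∂mu01) := by
  have hl : IsSchurKernel mu01 (lowerKernel (m + 1)) :=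
    isSchurKernel_lowerKernel m.succ_ne_zero
  have hu := isSchurKernel_upperKernel hm
  filter_upwards [hl.ae_integral_integral hu hf, hl.ae_integrable hf, hu.ae_integrable hf,
    ae_mu01_mem_Ioo] with x h1 h2 h3 hx
  rw [h1, ← integral_add h2 h3, ← MeasureTheory.integral_smul]
  refine integral_congr_ae ?_
  filter_upwards [ae_mu01_mem_Ioo] with t ht
  simp only [integral_lowerKernel_mul_upperKernel hx ht, mul_smul, add_smul]

theorem ae_upperKernel_lowerKernel_comp (hm : m ≠ 0) (hf : MemLp f 2 mu01) :
    ∀ᵐ x ∂mu01,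
      ∫ s, upperKernel m x s • ∫ t, lowerKernel (m + 1) s t • f t ∂mu01 ∂mu01 =
        (2 * m + 2 : ℝ)⁻¹ • (∫ t, lowerKernel (m + 1) x t • f t ∂mu01 +
          ∫ t, upperKernel m x t • f t ∂mu01 - x ^ m • ∫ t, t ^ (m + 1) • f t ∂mu01) := by
  have hl : IsSchurKernel mu01 (lowerKernel (m + 1)) :=
    isSchurKernel_lowerKernel m.succ_ne_zero
  have hu := isSchurKernel_upperKernel hm
  filter_upwards [hu.ae_integral_integral hl hf, hl.ae_integrable hf, hu.ae_integrable hf,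
    ae_mu01_mem_Ioo] with x h1 h2 h3 hx
  have h4 : Integrable (fun t => x ^ m • t ^ (m + 1) • f t) mu01 :=
    (integrable_pow_smul hf (m + 1)).smul (x ^ m)
  have h5 : Integrable (fun t => lowerKernel (m + 1) x t • f t + upperKernel m x t • f t) mu01 :=
    h2.add h3
  rw [h1, ← integral_add h2 h3, ← MeasureTheory.integral_smul (x ^ m), ← integral_sub h5 h4,
    ← MeasureTheory.integral_smul]
  refine integral_congr_ae ?_
  filter_upwards [ae_mu01_mem_Ioo] with t ht
  simp only [integral_upperKernel_mul_lowerKernel hx ht, mul_smul, add_smul, sub_smul]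

end Kernels

theorem exists_transform_pair {a : ℕ} (ha : 1 ≤ a) :
    ∃ S A : Lp ℂ 2 mu01 →L[ℂ] Lp ℂ 2 mu01,
      (∀ f : Lp ℂ 2 mu01, (S f : ℝ → ℂ) =ᵐ[mu01] fun x =>
        f x - ((4 * a * x ^ (2 * a - 1) : ℝ) : ℂ)
          * ∫ t in x..(1:ℝ), f t / (t : ℂ) ^ (2 * a)) ∧
      (∀ g : Lp ℂ 2 mu01, (A g : ℝ → ℂ) =ᵐ[mu01] fun x =>
        g x - ((4 * a : ℝ) : ℂ) / (x : ℂ) ^ (2 * a + 1)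
          * ∫ t in (0:ℝ)..x, (t : ℂ) ^ (2 * a) * g t) ∧
      (∀ f : Lp ℂ 2 mu01, A (S f) = f) ∧
      ∀ g : Lp ℂ 2 mu01,
        S (A g) = g ↔ ∫ x in (0:ℝ)..1, (g : ℝ → ℂ) x * ((x ^ (2 * a) : ℝ) : ℂ) = 0 := by
  obtain ⟨m, hm⟩ : ∃ m, 2 * a = m + 1 := ⟨2 * a - 1, by omega⟩
  have hm0 : m ≠ 0 := by omega
  have hma : (2 * m + 2 : ℝ) = 4 * a := by
    have : (2 * a : ℝ) = m + 1 := by exact_mod_cast hm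
    linarith
  have ha0 : (a : ℂ) ≠ 0 := by exact_mod_cast (by omega : a ≠ 0)
  obtain ⟨T, hT⟩ := (isSchurKernel_upperKernel hm0).exists_continuousLinearMap
  obtain ⟨B, hB⟩ := (isSchurKernel_lowerKernel (m := m + 1) m.succ_ne_zero).exists_continuousLinearMap
  have hBT (f : Lp ℂ 2 mu01) : B (T f) = (4 * a : ℂ)⁻¹ • (B f + T f) := by
    refine Lp.ext ?_
    filter_upwards [hB (T f), hB f, hT f, ae_lowerKernel_upperKernel_comp hm0 (Lp.memLp f),
      Lp.coeFn_smul (4 * a : ℂ)⁻¹ (B f + T f), Lp.coeFn_add (B f) (T f)] with x h1 h2 h3 h4 h5 h6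
    rw [h1, h5, Pi.smul_apply, h6, Pi.add_apply, h2, h3]
    calc _ = ∫ s, lowerKernel (m + 1) x s • ∫ t, upperKernel m s t • f t ∂mu01 ∂mu01 := by
          refine integral_congr_ae ?_
          filter_upwards [hT f] with s hs
          rw [hs]
      _ = _ := by
          rw [h4, hma, real_smul, smul_eq_mul]
          push_cast
          rfl
  have hTB (g : Lp ℂ 2 mu01) : ∀ᵐ x ∂mu01, (T (B g) : ℝ → ℂ) x =
      (4 * a : ℂ)⁻¹ * (((B g + T g : Lp ℂ 2 mu01) : ℝ → ℂ) x -
        (x : ℂ) ^ m * ∫ t in (0:ℝ)..1, (g : ℝ → ℂ) t * ((t ^ (2 * a) : ℝ) : ℂ)) := by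
    filter_upwards [hT (B g), hB g, hT g, ae_upperKernel_lowerKernel_comp hm0 (Lp.memLp g),
      Lp.coeFn_add (B g) (T g)] with x h1 h2 h3 h4 h6
    rw [h1, h6, Pi.add_apply, h2, h3]
    calc _ = ∫ s, upperKernel m x s • ∫ t, lowerKernel (m + 1) s t • g t ∂mu01 ∂mu01 := by
          refine integral_congr_ae ?_
          filter_upwards [hB g] with s hs
          rw [hs]
      _ = _ := by
          rw [h4, hma, real_smul, real_smul, integral_mu01_eq fun t => t ^ (m + 1) • g t, hm]
          simp only [real_smul, mul_comm (g _)]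
          push_cast
          rfl
  have hA_S (f : Lp ℂ 2 mu01) : (1 - (4 * a : ℂ) • B) ((1 - (4 * a : ℂ) • T) f) = f := by
    simp only [sub_apply, one_apply_eq_self,
      smul_apply, map_sub, map_smul, hBT]
    match_scalars <;> field_simp <;> ring
  have hS_A (g : Lp ℂ 2 mu01) : (1 - (4 * a : ℂ) • T) ((1 - (4 * a : ℂ) • B) g) = g ↔
      T (B g) = (4 * a : ℂ)⁻¹ • (B g + T g) := by
    have e : (1 - (4 * a : ℂ) • T) ((1 - (4 * a : ℂ) • B) g) - g =
        (4 * a : ℂ) ^ 2 • (T (B g) - (4 * a : ℂ)⁻¹ • (B g + T g)) := by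
      simp only [sub_apply, one_apply_eq_self,
        smul_apply, map_sub, map_smul]
      match_scalars <;> field_simp
      ring
    rw [← sub_eq_zero, e, smul_eq_zero_iff_right (by simp [ha0]), sub_eq_zero]
  refine ⟨1 - (4 * a : ℂ) • T, 1 - (4 * a : ℂ) • B, fun f => ?_, fun g => ?_, hA_S, fun g => ?_⟩
  · filter_upwards [Lp.coeFn_sub f ((4 * a : ℂ) • T f), Lp.coeFn_smul (4 * a : ℂ) (T f), hT f,
      ae_mu01_mem_Ioo] with x h1 h2 h3 hx
    simp only [sub_apply, one_apply_eq_self,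
      smul_apply]
    rw [h1, Pi.sub_apply, h2, Pi.smul_apply, h3, integral_upperKernel_smul hx, hm,
      Nat.add_sub_cancel, smul_eq_mul]
    push_cast
    ring
  · filter_upwards [Lp.coeFn_sub g ((4 * a : ℂ) • B g), Lp.coeFn_smul (4 * a : ℂ) (B g), hB g,
      ae_mu01_mem_Ioo] with x h1 h2 h3 hx
    simp only [sub_apply, one_apply_eq_self,
      smul_apply]
    rw [h1, Pi.sub_apply, h2, Pi.smul_apply, h3, integral_lowerKernel_smul hx, hm, smul_eq_mul]
    push_cast
    ring
  · rw [hS_A]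
    constructor
    · intro h
      have hae := hTB g
      rw [h] at hae
      obtain ⟨x, h1, h2, hx⟩ :=
        (hae.and ((Lp.coeFn_smul (4 * a : ℂ)⁻¹ (B g + T g)).and ae_mu01_mem_Ioo)).exists
      rw [h2, Pi.smul_apply, smul_eq_mul, mul_right_inj' (by simp [ha0])] at h1
      have hx0 : (x : ℂ) ^ m ≠ 0 := pow_ne_zero _ (ofReal_ne_zero.2 hx.1.ne')
      exact (mul_eq_zero_iff_left hx0).1 (by linear_combination h1)
    · intro h
      refine Lp.ext ?_
      filter_upwards [hTB g, Lp.coeFn_smul (4 * a : ℂ)⁻¹ (B g + T g)] with x h1 h2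
      rw [h1, h2, h, mul_zero, sub_zero, Pi.smul_apply, smul_eq_mul]

/-- `S_a` is a Banach isomorphism from `L²((0,1),ℂ)` onto the orthogonal
complement of `x ↦ x^{2a}`, with bounded inverse
`A_a g (x) = g(x) − (4a/x^{2a+1}) ∫₀^x t^{2a} g(t) dt`. -/
theorem statement12 :
    ∃ S A : ℕ → (Lp ℂ 2 mu01 →L[ℂ] Lp ℂ 2 mu01),
      (∀ a : ℕ, 1 ≤ a → ∀ f : Lp ℂ 2 mu01,
        (S a f : ℝ → ℂ) =ᵐ[mu01] fun x =>
          f x - ((4 * a * x ^ (2 * a - 1) : ℝ) : ℂ)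
                  * ∫ t in x..(1:ℝ), f t / (t : ℂ) ^ (2 * a)) ∧
      (∀ a : ℕ, 1 ≤ a → ∀ g : Lp ℂ 2 mu01,
        (A a g : ℝ → ℂ) =ᵐ[mu01] fun x =>
          g x - ((4 * a : ℝ) : ℂ) / (x : ℂ) ^ (2 * a + 1)
                  * ∫ t in (0:ℝ)..x, (t : ℂ) ^ (2 * a) * g t) ∧
      (∀ a : ℕ, 1 ≤ a →
        -- S_a is injective with range the orthogonal complement of x ↦ x^{2a},
        -- and A_a is a two-sided inverse on that complement
        (∀ f : Lp ℂ 2 mu01, A a (S a f) = f) ∧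
        Set.range (S a)
          = {g : Lp ℂ 2 mu01 |
              ∫ x in (0:ℝ)..1, (g : ℝ → ℂ) x * ((x ^ (2 * a) : ℝ) : ℂ) = 0} ∧
        (∀ g : Lp ℂ 2 mu01,
          (∫ x in (0:ℝ)..1, (g : ℝ → ℂ) x * ((x ^ (2 * a) : ℝ) : ℂ)) = 0 →
            S a (A a g) = g)) := by
  choose S A h using fun a (ha : 1 ≤ a) => exists_transform_pair ha
  refine ⟨fun a => if ha : 1 ≤ a then S a ha else 0, fun a => if ha : 1 ≤ a then A a ha else 0,
    fun a ha => ?_, fun a ha => ?_, fun a ha => ?_⟩ <;> simp only [dif_pos ha]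
  · exact (h a ha).1
  · exact (h a ha).2.1
  obtain ⟨-, -, hAS, hSA⟩ := h a ha
  refine ⟨hAS, Set.ext fun g => ⟨?_, fun hg => ⟨A a ha g, (hSA g).2 hg⟩⟩, fun g => (hSA g).2⟩
  rintro ⟨f, rfl⟩
  exact (hSA (S a ha f)).1 (congrArg (S a ha) (hAS f))
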